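/- arXiv:2112.13720 — 2 statements merged into one kernel-verified Lean document; each statement's English description precedes it below -/
import Mathlib

section
/- Let G be an n×n real symmetric positive semi-definite matrix, let ε, δ ∈ (0,1), and set s = ⌈8·ln(2/δ)/ε²⌉. If g₁,…,g_s are i.i.d. standard Gaussian vectors in ℝⁿ, then with probability at least 1−δ one has |tr(G) − (1/s)·Σ_{i=1}^s gᵢᵀ G gᵢ| ≤ ε·tr(G). -/
open MeasureTheory ProbabilityTheory Matrix

/-- Joint law of `s` i.i.d. standard Gaussian vectors in `ℝⁿ`
(each vector has `n` i.i.d. standard normal coordinates). -/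
noncomputable def gaussianVecs (s n : ℕ) : Measure (Fin s → Fin n → ℝ) :=
  Measure.pi fun _ => Measure.pi fun _ => gaussianReal 0 1

lemma exp_neg_add_sq_le_one_sub {x : ℝ} (hx : |x| ≤ 1 / 2) : Real.exp (-(x + x ^ 2)) ≤ 1 - x := by
  obtain ⟨h₁, h₂⟩ := abs_le.mp hx
  rw [Real.exp_neg, inv_le_comm₀ (Real.exp_pos _) (by linarith), inv_le_iff_one_le_mul₀' (by linarith)]
  rcases le_total x 0 with h | h
  · have := Real.add_one_le_exp (x + x ^ 2)
    nlinarith [pow_nonneg (neg_nonneg.mpr h) 3]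
  · have := Real.quadratic_le_exp_of_nonneg (x := x + x ^ 2) (by positivity)
    have h₃ : 1 ≤ (1 - x) * (1 + (x + x ^ 2) + (x + x ^ 2) ^ 2 / 2) := by
      have h₄ : 0 ≤ x ^ 2 * ((1 + x) ^ 2 * (1 - x) / 2 - x) := by
        refine mul_nonneg (sq_nonneg _) ?_
        nlinarith [mul_nonneg h (sub_nonneg.mpr h₂), mul_nonneg (mul_nonneg h h) (sub_nonneg.mpr h₂)]
      nlinarith
    exact h₃.trans (mul_le_mul_of_nonneg_left this (by linarith))

lemma integral_exp_mul_sq_gaussianReal {a : ℝ} (ha : a < 1 / 2) :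
    ∫ z, Real.exp (a * z ^ 2) ∂gaussianReal 0 1 = (√(1 - 2 * a))⁻¹ := by
  rw [integral_gaussianReal_eq_integral_smul one_ne_zero]
  have h (z : ℝ) : gaussianPDFReal 0 1 z • Real.exp (a * z ^ 2) =
      (√(2 * Real.pi))⁻¹ * Real.exp (-(1 / 2 - a) * z ^ 2) := by
    simp only [gaussianPDFReal, smul_eq_mul, NNReal.coe_one, mul_one, sub_zero, mul_assoc, ← Real.exp_add]
    ring_nf
  simp_rw [h]
  rw [integral_const_mul, integral_gaussian, ← Real.sqrt_inv, ← Real.sqrt_inv, ← Real.sqrt_mul (by positivity)]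
  congr 1
  have := Real.pi_pos
  have : 1 - 2 * a ≠ 0 := by linarith
  have : 1 / 2 - a ≠ 0 := by linarith
  field_simp

lemma lintegral_exp_mul_sq_gaussianReal_le {a : ℝ} (ha : |a| ≤ 1 / 4) :
    ∫⁻ z, ENNReal.ofReal (Real.exp (a * z ^ 2)) ∂gaussianReal 0 1 ≤
      ENNReal.ofReal (Real.exp (a + 2 * a ^ 2)) := by
  have ha' : a < 1 / 2 := by linarith [le_abs_self a]
  have hI := integral_exp_mul_sq_gaussianReal ha'
  have hpos : 0 < (√(1 - 2 * a))⁻¹ := inv_pos.mpr (Real.sqrt_pos.mpr (by linarith))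
  rw [← ofReal_integral_eq_lintegral_ofReal (Integrable.of_integral_ne_zero (hI ▸ hpos.ne'))
    (ae_of_all _ fun _ => (Real.exp_pos _).le), hI]
  refine ENNReal.ofReal_le_ofReal ?_
  have h2 : |2 * a| ≤ 1 / 2 := by rw [abs_mul, abs_two]; linarith
  rw [inv_le_comm₀ (Real.sqrt_pos.mpr (by linarith)) (Real.exp_pos _), ← Real.exp_neg]
  refine Real.le_sqrt_of_sq_le ((le_of_eq ?_).trans (exp_neg_add_sq_le_one_sub h2))
  rw [← Real.exp_nat_mul]
  ring_nf

lemma lintegral_pi_prod_eq_prod {ι : Type*} [Fintype ι] {E : ι → Type*}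
    {mE : ∀ i, MeasurableSpace (E i)} (μ : ∀ i, Measure (E i)) [∀ i, IsProbabilityMeasure (μ i)]
    {f : ∀ i, E i → ENNReal} (hf : ∀ i, Measurable (f i)) :
    ∫⁻ x, ∏ i, f i (x i) ∂Measure.pi μ = ∏ i, ∫⁻ x, f i x ∂μ i := by
  rw [lintegral_prod_eq_prod_lintegral_of_indepFun (X := fun i (x : ∀ i, E i) => f i (x i))
    Finset.univ (iIndepFun_pi fun i => (hf i).aemeasurable)
    fun i => (hf i).comp (measurable_pi_apply i)]
  exact Finset.prod_congr rfl fun i _ => (measurePreserving_eval μ i).lintegral_comp (hf i)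

lemma lintegral_pi_gaussianReal_comp_orthonormalBasis {n : ℕ}
    (b : OrthonormalBasis (Fin n) ℝ (EuclideanSpace ℝ (Fin n))) {F : (Fin n → ℝ) → ENNReal}
    (hF : Measurable F) :
    ∫⁻ x, F x ∂(Measure.pi fun _ => gaussianReal 0 1) =
      ∫⁻ z, F (∑ i, z i • (b i).ofLp) ∂(Measure.pi fun _ => gaussianReal 0 1) := by
  have hm : Measurable fun y : EuclideanSpace ℝ (Fin n) => F y.ofLp := by fun_prop
  have h : ∫⁻ x, F x ∂(Measure.pi fun _ => gaussianReal 0 1) =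
      ∫⁻ y, F y.ofLp ∂stdGaussian (EuclideanSpace ℝ (Fin n)) := by
    rw [← map_pi_eq_stdGaussian, lintegral_map hm (by fun_prop)]
  rw [h, stdGaussian_eq_map_pi_orthonormalBasis b, lintegral_map hm (by fun_prop)]
  simp

lemma Matrix.IsHermitian.quadraticForm_sum_eigenvectorBasis {n : ℕ} {G : Matrix (Fin n) (Fin n) ℝ}
    (hG : G.IsHermitian) (z : Fin n → ℝ) :
    (∑ i, z i • (hG.eigenvectorBasis i).ofLp) ⬝ᵥ G *ᵥ (∑ i, z i • (hG.eigenvectorBasis i).ofLp) =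
      ∑ i, hG.eigenvalues i * z i ^ 2 := by
  have h (i j : Fin n) : (hG.eigenvectorBasis i).ofLp ⬝ᵥ (hG.eigenvectorBasis j).ofLp =
      if i = j then 1 else 0 := by
    have := orthonormal_iff_ite.mp hG.eigenvectorBasis.orthonormal j i
    rw [EuclideanSpace.inner_eq_star_dotProduct] at this
    simpa [eq_comm] using this
  simp only [Matrix.mulVec_sum, Matrix.mulVec_smul, hG.mulVec_eigenvectorBasis, dotProduct_sum,
    sum_dotProduct, smul_dotProduct, dotProduct_smul, h, smul_eq_mul]
  simp only [mul_ite, mul_one, mul_zero, Finset.sum_ite_eq', Finset.mem_univ, if_true]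
  exact Finset.sum_congr rfl fun i _ => by ring

lemma lintegral_exp_quadraticForm_le {n : ℕ} {G : Matrix (Fin n) (Fin n) ℝ} (hG : G.PosSemidef)
    {t : ℝ} (ht : |t * G.trace| ≤ 1 / 4) :
    ∫⁻ x, ENNReal.ofReal (Real.exp (t * (x ⬝ᵥ G *ᵥ x))) ∂(Measure.pi fun _ => gaussianReal 0 1) ≤
      ENNReal.ofReal (Real.exp (t * G.trace + 2 * (t * G.trace) ^ 2)) := by
  have hH := hG.isHermitian
  set l := hH.eigenvalues with hl
  have hl0 : ∀ i, 0 ≤ l i := hG.eigenvalues_nonneg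
  have htr : G.trace = ∑ i, l i := by simpa using hH.trace_eq_sum_eigenvalues
  have hle (i : Fin n) : l i ≤ G.trace :=
    htr ▸ Finset.single_le_sum (fun j _ => hl0 j) (Finset.mem_univ i)
  have hsq : ∑ i, l i ^ 2 ≤ G.trace ^ 2 := by
    rw [sq G.trace]
    conv_rhs => rw [htr, Finset.sum_mul, ← htr]
    exact Finset.sum_le_sum fun i _ => by rw [sq]; exact mul_le_mul_of_nonneg_left (hle i) (hl0 i)
  rw [lintegral_pi_gaussianReal_comp_orthonormalBasis hH.eigenvectorBasis
    (by simp only [dotProduct, mulVec]; fun_prop)]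
  simp only [hH.quadraticForm_sum_eigenvectorBasis, Finset.mul_sum, Real.exp_sum, ← mul_assoc]
  simp only [ENNReal.ofReal_prod_of_nonneg fun i _ => (Real.exp_pos _).le]
  rw [lintegral_pi_prod_eq_prod _
    (f := fun i z => ENNReal.ofReal (Real.exp (t * l i * z ^ 2))) fun i => by fun_prop]
  calc ∏ i, ∫⁻ z, ENNReal.ofReal (Real.exp (t * l i * z ^ 2)) ∂gaussianReal 0 1
      ≤ ∏ i, ENNReal.ofReal (Real.exp (t * l i + 2 * (t * l i) ^ 2)) := by
        refine Finset.prod_le_prod' fun i _ => lintegral_exp_mul_sq_gaussianReal_le (le_trans ?_ ht)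
        rw [abs_mul, abs_mul, abs_of_nonneg (hl0 i), abs_of_nonneg ((hl0 i).trans (hle i))]
        exact mul_le_mul_of_nonneg_left (hle i) (abs_nonneg t)
    _ = ENNReal.ofReal (Real.exp (t * ∑ i, l i + 2 * t ^ 2 * ∑ i, l i ^ 2)) := by
        rw [← ENNReal.ofReal_prod_of_nonneg fun i _ => (Real.exp_pos _).le, ← Real.exp_sum,
          Finset.sum_add_distrib, Finset.mul_sum, Finset.mul_sum]
        simp only [mul_pow, mul_assoc]
    _ ≤ _ := by
        rw [← htr, mul_pow, ← mul_assoc]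
        gcongr

/-- Chernoff bound, covering both tails according to the sign of `c`. -/
lemma gaussianVecs_tail_le {s n : ℕ} {G : Matrix (Fin n) (Fin n) ℝ} (hG : G.PosSemidef)
    (hT : 0 < G.trace) {c : ℝ} (hc : |c| ≤ 1) :
    gaussianVecs s n {g | s * c ^ 2 * G.trace ≤ c * (∑ i, g i ⬝ᵥ G *ᵥ g i - s * G.trace)} ≤
      ENNReal.ofReal (Real.exp (-(s * c ^ 2 / 8))) := by
  set T := G.trace with hTdef
  set t := c / (4 * T) with ht
  have htT : t * T = c / 4 := by rw [ht]; field_simp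
  set F : (Fin s → Fin n → ℝ) → ENNReal := fun g =>
    ENNReal.ofReal (Real.exp (-(s * (c / 4 + c ^ 2 / 4)))) *
      ∏ i, ENNReal.ofReal (Real.exp (t * (g i ⬝ᵥ G *ᵥ g i))) with hF
  have hm : Measurable fun x : Fin n → ℝ => ENNReal.ofReal (Real.exp (t * (x ⬝ᵥ G *ᵥ x))) := by
    simp only [dotProduct, mulVec]; fun_prop
  have hp : Measurable fun g : Fin s → Fin n → ℝ =>
      ∏ i, ENNReal.ofReal (Real.exp (t * (g i ⬝ᵥ G *ᵥ g i))) :=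
    Finset.measurable_prod _ fun i _ => hm.comp (measurable_pi_apply i)
  refine (meas_le_lintegral₀ (f := F) (hp.const_mul _).aemeasurable fun g hg => ?_).trans ?_
  · rw [hF]
    dsimp only
    rw [← ENNReal.ofReal_prod_of_nonneg fun i _ => (Real.exp_pos _).le, ← Real.exp_sum,
      ← ENNReal.ofReal_mul (Real.exp_pos _).le, ← Real.exp_add, ENNReal.one_le_ofReal,
      Real.one_le_exp_iff, ← Finset.mul_sum]
    have hg' : s * c ^ 2 * T ≤ c * (∑ i, g i ⬝ᵥ G *ᵥ g i - s * T) := hg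
    have := div_le_div_of_nonneg_right hg' (by positivity : 0 ≤ 4 * T)
    have e : c * (∑ i, g i ⬝ᵥ G *ᵥ g i - s * T) / (4 * T) =
      t * ∑ i, g i ⬝ᵥ G *ᵥ g i - s * (c / 4) := by rw [ht]; field_simp
    have e' : s * c ^ 2 * T / (4 * T) = s * (c ^ 2 / 4) := by field_simp
    rw [e, e'] at this
    linarith
  · have hb := lintegral_exp_quadraticForm_le hG (t := t)
      (by rw [← hTdef, htT, abs_div, abs_of_pos (four_pos : (0:ℝ) < 4)]; linarith)
    rw [← hTdef, htT] at hb
    rw [hF, lintegral_const_mul _ hp, gaussianVecs, lintegral_pi_prod_eq_prod _ fun _ => hm]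
    refine (mul_le_mul_right (Finset.prod_le_prod' fun i _ => hb) _).trans ?_
    rw [Finset.prod_const, Finset.card_univ, Fintype.card_fin, ← ENNReal.ofReal_pow (Real.exp_pos _).le,
      ← Real.exp_nat_mul, ← ENNReal.ofReal_mul (Real.exp_pos _).le, ← Real.exp_add]
    apply le_of_eq
    ring_nf

/-- Gaussian trace estimator. For a symmetric PSD matrix `G` and
`s = ⌈8 ln(2/δ)/ε²⌉` i.i.d. standard Gaussian vectors, with probability at least `1−δ`,
`|tr(G) − (1/s)·Σᵢ gᵢᵀ G gᵢ| ≤ ε·tr(G)`. -/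
theorem stmt2 {n : ℕ} (G : Matrix (Fin n) (Fin n) ℝ) (hG : G.PosSemidef)
    (ε δ : ℝ) (hε : ε ∈ Set.Ioo (0 : ℝ) 1) (hδ : δ ∈ Set.Ioo (0 : ℝ) 1)
    (s : ℕ) (hs : s = ⌈8 * Real.log (2 / δ) / ε ^ 2⌉₊) :
    1 - ENNReal.ofReal δ ≤
      gaussianVecs s n
        {g | |G.trace - (1 / (s : ℝ)) * ∑ i, g i ⬝ᵥ G.mulVec (g i)| ≤ ε * G.trace} := by
  obtain ⟨hε₀, hε₁⟩ := hε
  obtain ⟨hδ₀, hδ₁⟩ := hδ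
  have : IsProbabilityMeasure (gaussianVecs s n) := by unfold gaussianVecs; infer_instance
  rcases hG.trace_nonneg.eq_or_lt with hT | hT
  · have hG0 := hG.trace_eq_zero_iff.mp hT.symm
    simp [hG0]
  have hlog : 0 < Real.log (2 / δ) := Real.log_pos (by rw [lt_div_iff₀ hδ₀]; linarith)
  have hs_le : 8 * Real.log (2 / δ) / ε ^ 2 ≤ s := hs ▸ Nat.le_ceil _
  have hs₀ : (0 : ℝ) < s := lt_of_lt_of_le (by positivity) hs_le
  have hexp : Real.exp (-(s * ε ^ 2 / 8)) ≤ δ / 2 := by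
    rw [div_le_iff₀ (by positivity)] at hs_le
    rw [← inv_div 2 δ, ← Real.exp_log (show 0 < 2 / δ by positivity), ← Real.exp_neg]
    exact Real.exp_le_exp.mpr (by linarith)
  set A := {g : Fin s → Fin n → ℝ |
    |G.trace - (1 / (s : ℝ)) * ∑ i, g i ⬝ᵥ G.mulVec (g i)| ≤ ε * G.trace}
  have hA : gaussianVecs s n Aᶜ ≤ ENNReal.ofReal δ := by
    have hsub : Aᶜ ⊆
        {g | s * ε ^ 2 * G.trace ≤ ε * (∑ i, g i ⬝ᵥ G *ᵥ g i - s * G.trace)} ∪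
        {g | s * (-ε) ^ 2 * G.trace ≤ -ε * (∑ i, g i ⬝ᵥ G *ᵥ g i - s * G.trace)} := by
      intro g hg
      have hg' : ε * G.trace < |G.trace - 1 / (s : ℝ) * ∑ i, g i ⬝ᵥ G *ᵥ g i| := not_le.mp hg
      set Q := ∑ i, g i ⬝ᵥ G *ᵥ g i with hQ
      have hQs : s * (1 / (s : ℝ) * Q) = Q := by field_simp
      have hεs : 0 < s * ε := by positivity
      rcases lt_abs.mp hg' with h | h
      · right
        change s * (-ε) ^ 2 * G.trace ≤ -ε * (Q - s * G.trace)
        nlinarith [mul_lt_mul_of_pos_left h hεs]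
      · left
        change s * ε ^ 2 * G.trace ≤ ε * (Q - s * G.trace)
        nlinarith [mul_lt_mul_of_pos_left h hεs]
    have h₁ := gaussianVecs_tail_le (s := s) hG hT (c := ε) (by rw [abs_of_pos hε₀]; exact hε₁.le)
    have h₂ := gaussianVecs_tail_le (s := s) hG hT (c := -ε)
      (by rw [abs_neg, abs_of_pos hε₀]; exact hε₁.le)
    rw [neg_sq] at h₂
    have h₀ := ENNReal.ofReal_le_ofReal hexp
    calc gaussianVecs s n Aᶜ ≤ _ := (measure_mono hsub).trans (measure_union_le _ _)
      _ ≤ ENNReal.ofReal (δ / 2) + ENNReal.ofReal (δ / 2) := by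
        rw [neg_sq]
        exact add_le_add (h₁.trans h₀) (h₂.trans h₀)
      _ = ENNReal.ofReal δ := by rw [← ENNReal.ofReal_add (by positivity) (by positivity), add_halves]
  rw [tsub_le_iff_right]
  calc 1 = gaussianVecs s n (A ∪ Aᶜ) := by rw [Set.union_compl_self, measure_univ]
    _ ≤ _ := (measure_union_le _ _).trans (add_le_add_right hA _)
end

section
/- Let G be an n×n real symmetric positive definite matrix with smallest eigenvalue λ_min > 0, largest eigenvalue λ_max, and condition number κ = λ_max/λ_min. Let α > 0 be a non-integer real with α ≠ 1, let ε ∈ (0,1/3), δ ∈ (0,1), set s = ⌈8·ln(2/δ)/ε²⌉, and let m be an integer with m > α satisfying κ^{α+1}·Γ(α+1)·(1−1/κ)^{m+1} ≤ ε·π·(m−α+1)^{α+1} (the condition whose solution the paper expresses via the Lambert W function). Let g₁,…,g_s be i.i.d. standard Gaussian vectors in ℝⁿ and define the Taylor-series estimator S̃_α(G) = (1/(1−α))·log₂((λ_max^α/s)·Σ_{i=1}^s Σ_{j=0}^m binom(α,j)·gᵢᵀ(G/λ_max − I)ʲ gᵢ). Then with probability at least 1−δ one has |S_α(G) − S̃_α(G)|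 ≤ |(1/(1−α))·log₂(1−3ε)|. -/
open MeasureTheory ProbabilityTheory Matrix

/-- Generalized binomial coefficient `binom(α, i) = α(α−1)⋯(α−i+1)/i!` for real `α`. -/
noncomputable def rchoose (α : ℝ) (i : ℕ) : ℝ :=
  (∏ j ∈ Finset.range i, (α - j)) / (Nat.factorial i)

lemma rchoose_eq_ringChoose (α : ℝ) (i : ℕ) : rchoose α i = Ring.choose α i := by
  rw [Ring.choose_eq_smul, ← Polynomial.aeval_eq_smeval, ← Polynomial.eval_map_algebraMap,
    algebraMap_int_eq, descPochhammer_map, descPochhammer_eval_eq_prod_range, rchoose, smul_eq_mul]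
  ring

lemma rchoose_mul_Gamma {α : ℝ} (hni : ∀ k : ℕ, α ≠ k) (i : ℕ) :
    rchoose α i * (Nat.factorial i * Real.Gamma (α - i + 1)) = Real.Gamma (α + 1) := by
  induction i with
  | zero => simp [rchoose]
  | succ i ih =>
    have h : α - i ≠ 0 := sub_ne_zero.mpr (hni i)
    have h1 : (Nat.factorial i : ℝ) ≠ 0 := by positivity
    rw [← ih, Real.Gamma_add_one h]
    simp only [rchoose, Finset.prod_range_succ, Nat.factorial_succ]
    push_cast
    rw [show α - ((i : ℝ) + 1) + 1 = α - i by ring]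
    field_simp

lemma Gamma_mul_rpow_le {x β : ℝ} (hx : 0 < x) (hβ : 1 ≤ β) :
    Real.Gamma x * x ^ β ≤ Real.Gamma (x + β) := by
  have hβ0 : 0 < β := by linarith
  have hΓ := Real.Gamma_pos_of_pos hx
  have hΓβ := Real.Gamma_pos_of_pos (show 0 < x + β by linarith)
  have h := Real.convexOn_log_Gamma.2 (Set.mem_Ioi.mpr hx)
    (Set.mem_Ioi.mpr (show 0 < x + β by linarith))
    (show 0 ≤ 1 - 1 / β by rw [sub_nonneg, div_le_one hβ0]; exact hβ)
    (show 0 ≤ 1 / β by positivity) (by ring)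
  simp only [smul_eq_mul, Function.comp] at h
  rw [show (1 - 1 / β) * x + 1 / β * (x + β) = x + 1 by field_simp; ring,
    Real.Gamma_add_one hx.ne', Real.log_mul hx.ne' hΓ.ne'] at h
  have h2 : Real.log (Real.Gamma x) + β * Real.log x ≤ Real.log (Real.Gamma (x + β)) := by
    have := mul_le_mul_of_nonneg_left h hβ0.le
    have e : β * ((1 - 1 / β) * Real.log (Real.Gamma x)
        + 1 / β * Real.log (Real.Gamma (x + β)))
        = β * Real.log (Real.Gamma x) - Real.log (Real.Gamma x)
          + Real.log (Real.Gamma (x + β)) := by field_simp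
    linarith
  rw [← Real.log_le_log_iff (by positivity) hΓβ, Real.log_mul hΓ.ne' (by positivity),
    Real.log_rpow hx]
  exact h2

lemma abs_rchoose_le {α : ℝ} (hα : 0 < α) (hni : ∀ k : ℕ, α ≠ k) {i : ℕ} (hi : α < i) :
    |rchoose α i| ≤ Real.Gamma (α + 1) / (Real.pi * ((i : ℝ) - α) ^ (α + 1)) := by
  have hx : 0 < (i : ℝ) - α := by linarith
  have hΓ := Real.Gamma_pos_of_pos hx
  have hΓα := Real.Gamma_pos_of_pos (show 0 < α + 1 by linarith)
  have hgrow := Gamma_mul_rpow_le hx (show 1 ≤ α + 1 by linarith)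
  rw [show (i : ℝ) - α + (α + 1) = i + 1 by ring, Real.Gamma_nat_eq_factorial] at hgrow
  have hrec := rchoose_mul_Gamma hni i
  have hrefl := Real.Gamma_mul_Gamma_one_sub ((i : ℝ) - α)
  rw [show 1 - ((i : ℝ) - α) = α - i + 1 by ring] at hrefl
  have hsin : Real.sin (Real.pi * (i - α)) ≠ 0 := by
    intro h0
    rw [h0, div_zero] at hrefl
    rcases mul_eq_zero.mp hrefl with h | h
    · exact hΓ.ne' h
    · rw [h] at hrec; simp at hrec; exact hΓα.ne hrec
  have key : rchoose α i * (Nat.factorial i * Real.pi)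
      = Real.Gamma (α + 1) * (Real.Gamma (i - α) * Real.sin (Real.pi * (i - α))) := by
    rw [← hrec]
    have : Real.Gamma (i - α) * Real.Gamma (α - i + 1) * Real.sin (Real.pi * (i - α))
        = Real.pi := by rw [hrefl]; field_simp
    linear_combination (-(rchoose α i * Nat.factorial i)) * this
  have hp : 0 < ((i : ℝ) - α) ^ (α + 1) := by positivity
  have hf : (0 : ℝ) < Nat.factorial i := by positivity
  have habs : |rchoose α i| * (Nat.factorial i * Real.pi)
      ≤ Real.Gamma (α + 1) * Real.Gamma (i - α) := by
    rw [← abs_of_pos (show (0 : ℝ) < Nat.factorial i * Real.pi by positivity), ← abs_mul, key,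
      abs_mul, abs_mul, abs_of_pos hΓα, abs_of_pos hΓ]
    have := Real.abs_sin_le_one (Real.pi * (i - α))
    gcongr
    exact mul_le_of_le_one_right hΓ.le this
  rw [le_div_iff₀ (by positivity)]
  have h3 : |rchoose α i| * (Nat.factorial i * Real.pi) * ((i : ℝ) - α) ^ (α + 1)
      ≤ Real.Gamma (α + 1) * Nat.factorial i := by
    calc _ ≤ Real.Gamma (α + 1) * Real.Gamma (i - α) * ((i : ℝ) - α) ^ (α + 1) := by gcongr
      _ = Real.Gamma (α + 1) * (Real.Gamma (i - α) * ((i : ℝ) - α) ^ (α + 1)) := by ring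
      _ ≤ _ := by gcongr
  refine le_of_mul_le_mul_right ?_ hf
  linarith

lemma hasSum_rchoose (α : ℝ) {t : ℝ} (ht : |t| < 1) :
    HasSum (fun j ↦ rchoose α j * t ^ j) ((1 + t) ^ α) := by
  have h := (Real.one_add_rpow_hasFPowerSeriesOnBall_zero (a := α)).hasSum (y := t)
    (by simpa [Metric.mem_eball, edist_dist] using ht)
  simpa [binomialSeries, FormalMultilinearSeries.coeff_ofScalars, rchoose_eq_ringChoose,
    mul_comm] using h

lemma abs_rpow_sub_sum_rchoose_le {α : ℝ} (hα : 0 < α) (hni : ∀ k : ℕ, α ≠ k) {m : ℕ}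
    (hm : α < m) {x : ℝ} (hx0 : 0 < x) (hx1 : x ≤ 1) :
    |(∑ j ∈ Finset.range (m + 1), rchoose α j * (x - 1) ^ j) - x ^ α| ≤
      Real.Gamma (α + 1) / (Real.pi * ((m : ℝ) - α + 1) ^ (α + 1)) * ((1 - x) ^ (m + 1) / x) := by
  set C := Real.Gamma (α + 1) / (Real.pi * ((m : ℝ) - α + 1) ^ (α + 1)) with hC
  have hΓα := Real.Gamma_pos_of_pos (show 0 < α + 1 by linarith)
  have h := hasSum_rchoose α (t := x - 1) (by rw [abs_lt]; constructor <;> linarith)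
  rw [show 1 + (x - 1) = x by ring] at h
  have htail := (hasSum_nat_add_iff' (m + 1)).mpr h
  have hgeo := ((hasSum_geometric_of_lt_one (show 0 ≤ 1 - x by linarith)
    (show 1 - x < 1 by linarith)).mul_left (C * (1 - x) ^ (m + 1)))
  have hb : ∀ j : ℕ, ‖rchoose α (j + (m + 1)) * (x - 1) ^ (j + (m + 1))‖
      ≤ C * (1 - x) ^ (m + 1) * (1 - x) ^ j := by
    intro j
    have hj0 : (0 : ℝ) ≤ j := j.cast_nonneg
    have hj : α < ((j + (m + 1) : ℕ) : ℝ) := by push_cast; linarith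
    have h1 := abs_rchoose_le hα hni hj
    have h2 : Real.Gamma (α + 1) / (Real.pi * (((j + (m + 1) : ℕ) : ℝ) - α) ^ (α + 1)) ≤ C := by
      rw [hC]
      have : 0 < (m : ℝ) - α + 1 := by linarith
      gcongr
      push_cast; linarith
    rw [Real.norm_eq_abs, abs_mul, abs_pow, abs_sub_comm, abs_of_nonneg (show 0 ≤ 1 - x by linarith),
      mul_assoc, ← pow_add, add_comm (m + 1) j]
    gcongr
    exact h1.trans h2
  have := htail.norm_le_of_bounded hgeo hb
  rw [abs_sub_comm]
  rw [Real.norm_eq_abs, show (1 - (1 - x))⁻¹ = x⁻¹ by ring] at this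
  calc _ ≤ _ := this
    _ = _ := by ring

lemma abs_taylor_sub_rpow_le {α κ ε : ℝ} (hα : 0 < α) (hni : ∀ k : ℕ, α ≠ k) {m : ℕ}
    (hm : α < m) (hκ : 0 < κ) {x : ℝ} (hx0 : 1 / κ ≤ x) (hx1 : x ≤ 1)
    (hcond : κ ^ (α + 1) * Real.Gamma (α + 1) * (1 - 1 / κ) ^ (m + 1)
        ≤ ε * Real.pi * ((m : ℝ) - α + 1) ^ (α + 1)) :
    |(∑ j ∈ Finset.range (m + 1), rchoose α j * (x - 1) ^ j) - x ^ α| ≤ ε * x ^ α := by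
  have hκi : 0 < 1 / κ := by positivity
  have hxp : 0 < x := by linarith
  have hΓα := Real.Gamma_pos_of_pos (show 0 < α + 1 by linarith)
  refine (abs_rpow_sub_sum_rchoose_le hα hni hm hxp hx1).trans ?_
  have hm1 : 0 < (m : ℝ) - α + 1 := by linarith
  have hP : 0 < ((m : ℝ) - α + 1) ^ (α + 1) := by positivity
  have h1 : (1 - x) ^ (m + 1) ≤ (1 - 1 / κ) ^ (m + 1) := by
    have : 0 ≤ 1 - x := by linarith
    gcongr
  have h2 : 1 ≤ κ ^ (α + 1) * x ^ (α + 1) := by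
    rw [← Real.mul_rpow hκ.le hxp.le]
    apply Real.one_le_rpow _ (by linarith)
    rw [div_le_iff₀ hκ] at hx0
    linarith
  have h3 : x ^ (α + 1) = x ^ α * x := by rw [Real.rpow_add_one hxp.ne']
  have hnn : 0 ≤ (1 - 1 / κ) ^ (m + 1) := pow_nonneg (by linarith) _
  rw [div_mul_div_comm, div_le_iff₀ (by positivity)]
  calc Real.Gamma (α + 1) * (1 - x) ^ (m + 1)
      ≤ Real.Gamma (α + 1) * (1 - 1 / κ) ^ (m + 1) := by gcongr
    _ ≤ Real.Gamma (α + 1) * (1 - 1 / κ) ^ (m + 1) * (κ ^ (α + 1) * x ^ (α + 1)) :=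
        le_mul_of_one_le_right (by positivity) h2
    _ = κ ^ (α + 1) * Real.Gamma (α + 1) * (1 - 1 / κ) ^ (m + 1) * x ^ (α + 1) := by ring
    _ ≤ ε * Real.pi * ((m : ℝ) - α + 1) ^ (α + 1) * x ^ (α + 1) := by gcongr
    _ = _ := by rw [h3]; ring

lemma integrable_exp_mul_sq_gaussianReal {u : ℝ} (hu : u < 1 / 2) :
    Integrable (fun z ↦ Real.exp (u * z ^ 2)) (gaussianReal 0 1) ∧
      ∫ z, Real.exp (u * z ^ 2) ∂(gaussianReal 0 1) = (√(1 - 2 * u))⁻¹ := by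
  have hb : 0 < 1 / 2 - u := by linarith
  have e : ∀ z : ℝ, gaussianPDFReal 0 1 z • Real.exp (u * z ^ 2)
      = (√(2 * Real.pi))⁻¹ * Real.exp (-(1 / 2 - u) * z ^ 2) := by
    intro z
    rw [gaussianPDFReal_def, smul_eq_mul, NNReal.coe_one, mul_assoc, ← Real.exp_add]
    ring_nf
  have hint : Integrable (fun z ↦ gaussianPDFReal 0 1 z • Real.exp (u * z ^ 2)) := by
    simp_rw [e]
    exact (integrable_exp_neg_mul_sq hb).const_mul _
  constructor
  · rw [gaussianReal_of_var_ne_zero _ one_ne_zero,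
      integrable_withDensity_iff_integrable_smul' (measurable_gaussianPDF _ _)
        (ae_of_all _ fun _ ↦ gaussianPDF_lt_top)]
    simpa [toReal_gaussianPDF] using hint
  · rw [integral_gaussianReal_eq_integral_smul one_ne_zero]
    simp_rw [e]
    rw [integral_const_mul, integral_gaussian, ← Real.sqrt_inv, ← Real.sqrt_inv,
      ← Real.sqrt_mul (by positivity)]
    congr 1
    have : 1 - 2 * u ≠ 0 := by linarith
    have : 1 / 2 - u ≠ 0 := hb.ne'
    have := Real.pi_ne_zero
    field_simp

lemma inv_sqrt_one_sub_le {u : ℝ} (hu : |u| ≤ 1 / 12) :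
    (√(1 - 2 * u))⁻¹ ≤ Real.exp (u + 2 * u ^ 2) := by
  obtain ⟨h1, h2⟩ := abs_le.mp hu
  have hpos : 0 < 1 - 2 * u := by linarith
  have key : Real.exp (-(2 * (u + 2 * u ^ 2))) ≤ 1 - 2 * u := by
    rw [← Real.le_log_iff_exp_le hpos]
    have hu' : |2 * u| ≤ 1 / 6 := by rw [abs_mul, abs_two]; linarith
    have hb := Real.abs_log_sub_add_sum_range_le (x := 2 * u) (by linarith) 2
    have h3 : |2 * u| ^ (2 + 1) / (1 - |2 * u|) ≤ (2 * u) ^ 2 / 2 := by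
      rw [div_le_iff₀ (by linarith), ← sq_abs (2 * u)]
      nlinarith [mul_nonneg (sq_nonneg |2 * u|) (sub_nonneg.mpr hu')]
    have h4 := (abs_le.mp (hb.trans h3)).1
    simp only [Finset.sum_range_succ, Finset.sum_range_zero] at h4
    norm_num at h4
    linarith
  rw [inv_le_comm₀ (by positivity) (by positivity), ← Real.exp_neg]
  apply Real.le_sqrt_of_sq_le
  rw [← Real.exp_nat_mul]
  calc _ = Real.exp (-(2 * (u + 2 * u ^ 2))) := by congr 1; push_cast; ring
    _ ≤ _ := key

lemma measurePreserving_orthonormalBasis_coord {ι : Type*} [Fintype ι]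
    (b : OrthonormalBasis ι ℝ (EuclideanSpace ℝ ι)) :
    MeasurePreserving (fun (g : ι → ℝ) k ↦ b.repr (WithLp.toLp 2 g) k)
      (Measure.pi fun _ ↦ gaussianReal 0 1) (Measure.pi fun _ ↦ gaussianReal 0 1) := by
  classical
  refine ⟨by fun_prop, ?_⟩
  have h1 := map_pi_eq_stdGaussian (ι := ι)
  have h2 := stdGaussian_eq_map_pi_orthonormalBasis b
  have e : (fun (g : ι → ℝ) k ↦ b.repr (WithLp.toLp 2 g) k)
      = (fun (v : EuclideanSpace ℝ ι) k ↦ b.repr v k) ∘ WithLp.toLp 2 := rfl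
  rw [e, ← Measure.map_map (by fun_prop) (by fun_prop), h1, h2,
    Measure.map_map (by fun_prop) (by fun_prop)]
  convert Measure.map_id using 1
  congr 1
  ext x k
  simp [b.repr_apply_apply, inner_sum, real_inner_smul_right,
    orthonormal_iff_ite.mp b.orthonormal]

lemma dotProduct_pow_mulVec_eq_sum {n : ℕ} {G : Matrix (Fin n) (Fin n) ℝ} (hG : G.IsHermitian)
    (c : ℝ) (j : ℕ) (g : Fin n → ℝ) :
    g ⬝ᵥ ((c • G - 1) ^ j).mulVec g
      = ∑ k, (c * hG.eigenvalues k - 1) ^ j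
          * hG.eigenvectorBasis.repr (WithLp.toLp 2 g) k ^ 2 := by
  set b := hG.eigenvectorBasis with hb
  have hpow : ∀ k, ((c • G - 1) ^ j).mulVec (b k).ofLp
      = (c * hG.eigenvalues k - 1) ^ j • (b k).ofLp := by
    intro k
    induction j with
    | zero => simp
    | succ j ih =>
      rw [pow_succ, ← Matrix.mulVec_mulVec, Matrix.sub_mulVec, Matrix.smul_mulVec,
        hG.mulVec_eigenvectorBasis, Matrix.one_mulVec, ← hb]
      rw [show c • hG.eigenvalues k • (b k).ofLp - (b k).ofLp
          = (c * hG.eigenvalues k - 1) • (b k).ofLp by module, Matrix.mulVec_smul, ih, smul_smul,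
        pow_succ']
  have hg : g = ∑ k, b.repr (WithLp.toLp 2 g) k • (b k).ofLp := by
    have := b.sum_repr (WithLp.toLp 2 g)
    have := congrArg WithLp.ofLp this
    simpa using this.symm
  have hdot : ∀ k, g ⬝ᵥ (b k).ofLp = b.repr (WithLp.toLp 2 g) k := by
    intro k
    rw [b.repr_apply_apply, EuclideanSpace.inner_eq_star_dotProduct]
    simp
  have hexp : ((c • G - 1) ^ j).mulVec g = ∑ k, b.repr (WithLp.toLp 2 g) k •
      (c * hG.eigenvalues k - 1) ^ j • (b k).ofLp := by
    conv_lhs => rw [hg]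
    simp only [Matrix.mulVec_sum, Matrix.mulVec_smul, hpow]
  rw [hexp, dotProduct_sum]
  refine Finset.sum_congr rfl fun k _ ↦ ?_
  rw [dotProduct_smul, dotProduct_smul, hdot, smul_eq_mul, smul_eq_mul]
  ring

lemma exp_sum_coord_sq {n : ℕ} (b : OrthonormalBasis (Fin n) ℝ (EuclideanSpace ℝ (Fin n)))
    {a : Fin n → ℝ} (ha : ∀ k, 0 ≤ a k) (hsum : ∑ k, a k = 1) {t : ℝ} (ht : |t| ≤ 1 / 12) :
    Integrable (fun g : Fin n → ℝ ↦
        Real.exp (t * ∑ k, a k * b.repr (WithLp.toLp 2 g) k ^ 2))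
        (Measure.pi fun _ ↦ gaussianReal 0 1) ∧
      ∫ g : Fin n → ℝ, Real.exp (t * ∑ k, a k * b.repr (WithLp.toLp 2 g) k ^ 2)
        ∂(Measure.pi fun _ ↦ gaussianReal 0 1) ≤ Real.exp (t + 2 * t ^ 2) := by
  have ha1 : ∀ k, a k ≤ 1 := fun k ↦
    hsum ▸ Finset.single_le_sum (fun i _ ↦ ha i) (Finset.mem_univ k)
  have hta : ∀ k, |t * a k| ≤ 1 / 12 := fun k ↦ by
    rw [abs_mul, abs_of_nonneg (ha k)]
    exact (mul_le_of_le_one_right (abs_nonneg t) (ha1 k)).trans ht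
  have hint : ∀ k, Integrable (fun z ↦ Real.exp (t * a k * z ^ 2)) (gaussianReal 0 1) := fun k ↦
    (integrable_exp_mul_sq_gaussianReal (by linarith [(abs_le.mp (hta k)).2])).1
  have hval : ∀ k, ∫ z, Real.exp (t * a k * z ^ 2) ∂(gaussianReal 0 1)
      ≤ Real.exp (t * a k + 2 * (t * a k) ^ 2) := fun k ↦ by
    rw [(integrable_exp_mul_sq_gaussianReal (by linarith [(abs_le.mp (hta k)).2])).2]
    exact inv_sqrt_one_sub_le (hta k)
  have hmp := measurePreserving_orthonormalBasis_coord b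
  have e : (fun g : Fin n → ℝ ↦ Real.exp (t * ∑ k, a k * b.repr (WithLp.toLp 2 g) k ^ 2))
      = (fun z : Fin n → ℝ ↦ ∏ k, Real.exp (t * a k * z k ^ 2))
        ∘ (fun g k ↦ b.repr (WithLp.toLp 2 g) k) := by
    ext g
    simp [← Real.exp_sum, Finset.mul_sum, mul_assoc]
  have hintz := Integrable.fintype_prod (μ := fun _ : Fin n ↦ gaussianReal 0 1) hint
  constructor
  · rw [e]
    exact hmp.integrable_comp_of_integrable hintz
  · rw [e]
    have hmap := integral_map (μ := Measure.pi fun _ : Fin n ↦ gaussianReal 0 1)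
      hmp.measurable.aemeasurable (f := fun z : Fin n → ℝ ↦ ∏ k, Real.exp (t * a k * z k ^ 2))
      (by rw [hmp.map_eq]; exact hintz.aestronglyMeasurable)
    rw [hmp.map_eq] at hmap
    simp only [Function.comp_def]
    rw [← hmap, integral_fintype_prod_eq_prod (fun k z ↦ Real.exp (t * a k * z ^ 2))]
    calc _ ≤ ∏ k, Real.exp (t * a k + 2 * (t * a k) ^ 2) :=
          Finset.prod_le_prod (fun k _ ↦ integral_nonneg fun _ ↦ (Real.exp_pos _).le)
            fun k _ ↦ hval k
      _ = Real.exp (∑ k, (t * a k + 2 * (t * a k) ^ 2)) := (Real.exp_sum _ _).symm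
      _ ≤ Real.exp (∑ k, (t + 2 * t ^ 2) * a k) := by
          refine Real.exp_le_exp.mpr (Finset.sum_le_sum fun k _ ↦ ?_)
          nlinarith [mul_nonneg (mul_nonneg (sq_nonneg t) (ha k)) (sub_nonneg.mpr (ha1 k))]
      _ = _ := by rw [← Finset.mul_sum, hsum, mul_one]

instance isProbabilityMeasure_gaussianVecs (s n : ℕ) :
    IsProbabilityMeasure (gaussianVecs s n) := by
  unfold gaussianVecs; infer_instance

lemma mgf_gaussianVecs_le {s n : ℕ} (b : OrthonormalBasis (Fin n) ℝ (EuclideanSpace ℝ (Fin n)))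
    {a : Fin n → ℝ} (ha : ∀ k, 0 ≤ a k) (hsum : ∑ k, a k = 1) {t : ℝ} (ht : |t| ≤ 1 / 12) :
    Integrable (fun g : Fin s → Fin n → ℝ ↦
        Real.exp (t * ∑ i, ∑ k, a k * b.repr (WithLp.toLp 2 (g i)) k ^ 2)) (gaussianVecs s n) ∧
      mgf (fun g : Fin s → Fin n → ℝ ↦ ∑ i, ∑ k, a k * b.repr (WithLp.toLp 2 (g i)) k ^ 2)
        (gaussianVecs s n) t ≤ Real.exp (s * (t + 2 * t ^ 2)) := by
  obtain ⟨hint, hle⟩ := exp_sum_coord_sq b ha hsum ht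
  have e : (fun g : Fin s → Fin n → ℝ ↦
        Real.exp (t * ∑ i, ∑ k, a k * b.repr (WithLp.toLp 2 (g i)) k ^ 2))
      = fun g ↦ ∏ i, Real.exp (t * ∑ k, a k * b.repr (WithLp.toLp 2 (g i)) k ^ 2) := by
    ext g
    rw [← Real.exp_sum, Finset.mul_sum]
  unfold mgf
  rw [e, gaussianVecs]
  refine ⟨Integrable.fintype_prod fun _ ↦ hint, ?_⟩
  rw [integral_fintype_prod_eq_pow (ι := Fin s)
    (f := fun g : Fin n → ℝ ↦ Real.exp (t * ∑ k, a k * b.repr (WithLp.toLp 2 g) k ^ 2)),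
    Fintype.card_fin, Real.exp_nat_mul]
  exact pow_le_pow_left₀ (integral_nonneg fun _ ↦ (Real.exp_pos _).le) hle s

lemma gaussianVecs_concentration_of_sum_eq_one {s n : ℕ}
    (b : OrthonormalBasis (Fin n) ℝ (EuclideanSpace ℝ (Fin n)))
    {a : Fin n → ℝ} (ha : ∀ k, 0 ≤ a k) (hsum : ∑ k, a k = 1) {ε δ : ℝ}
    (hε : ε ∈ Set.Ioo (0 : ℝ) (1 / 3)) (hδ : 0 < δ)
    (hs : 8 * Real.log (2 / δ) / ε ^ 2 ≤ s) :
    1 - ENNReal.ofReal δ ≤ gaussianVecs s n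
      {g | s * (1 - ε) < ∑ i, ∑ k, a k * b.repr (WithLp.toLp 2 (g i)) k ^ 2 ∧
        ∑ i, ∑ k, a k * b.repr (WithLp.toLp 2 (g i)) k ^ 2 < s * (1 + ε)} := by
  obtain ⟨hε0, hε1⟩ := hε
  set Q := fun g : Fin s → Fin n → ℝ ↦ ∑ i, ∑ k, a k * b.repr (WithLp.toLp 2 (g i)) k ^ 2 with hQ
  have htail : Real.exp (-(s * ε ^ 2 / 8)) ≤ δ / 2 := by
    rw [div_le_iff₀ (by positivity)] at hs
    rw [← Real.le_log_iff_exp_le (by positivity), ← inv_div 2 δ, Real.log_inv]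
    linarith
  obtain ⟨hi1, hm1⟩ := mgf_gaussianVecs_le (s := s) b ha hsum (t := ε / 4)
    (by rw [abs_of_pos (by linarith)]; linarith)
  obtain ⟨hi2, hm2⟩ := mgf_gaussianVecs_le (s := s) b ha hsum (t := -(ε / 4))
    (by rw [abs_neg, abs_of_pos (by linarith)]; linarith)
  have hu : (gaussianVecs s n).real {g | s * (1 + ε) ≤ Q g} ≤ δ / 2 := by
    refine (measure_ge_le_exp_mul_mgf (t := ε / 4) _ (by linarith) hi1).trans ?_
    refine (mul_le_mul_of_nonneg_left hm1 (Real.exp_pos _).le).trans ?_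
    rw [← Real.exp_add]
    refine le_trans (le_of_eq ?_) htail
    congr 1; ring
  have hl : (gaussianVecs s n).real {g | Q g ≤ s * (1 - ε)} ≤ δ / 2 := by
    refine (measure_le_le_exp_mul_mgf (t := -(ε / 4)) _ (by linarith) hi2).trans ?_
    refine (mul_le_mul_of_nonneg_left hm2 (Real.exp_pos _).le).trans ?_
    rw [← Real.exp_add]
    refine le_trans (le_of_eq ?_) htail
    congr 1; ring
  set good := {g | s * (1 - ε) < Q g ∧ Q g < s * (1 + ε)} with hgood
  have hcover : (Set.univ : Set (Fin s → Fin n → ℝ))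
      ⊆ good ∪ ({g | s * (1 + ε) ≤ Q g} ∪ {g | Q g ≤ s * (1 - ε)}) := by
    intro g _
    by_cases h1 : s * (1 + ε) ≤ Q g
    · exact Or.inr (Or.inl h1)
    by_cases h2 : Q g ≤ s * (1 - ε)
    · exact Or.inr (Or.inr h2)
    · exact Or.inl ⟨not_le.mp h2, not_le.mp h1⟩
  rw [tsub_le_iff_right]
  calc (1 : ENNReal) = gaussianVecs s n Set.univ := measure_univ.symm
    _ ≤ gaussianVecs s n good + (gaussianVecs s n {g | s * (1 + ε) ≤ Q g}
          + gaussianVecs s n {g | Q g ≤ s * (1 - ε)}) :=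
        (measure_mono hcover).trans ((measure_union_le _ _).trans
          (add_le_add_right (measure_union_le _ _) _))
    _ ≤ gaussianVecs s n good + (ENNReal.ofReal (δ / 2) + ENNReal.ofReal (δ / 2)) := by
        gcongr
        · exact (ENNReal.le_ofReal_iff_toReal_le (measure_ne_top _ _) (by linarith)).mpr hu
        · exact (ENNReal.le_ofReal_iff_toReal_le (measure_ne_top _ _) (by linarith)).mpr hl
    _ = _ := by rw [← ENNReal.ofReal_add (by linarith) (by linarith), add_halves]

lemma gaussianVecs_concentration {s n : ℕ}
    (b : OrthonormalBasis (Fin n) ℝ (EuclideanSpace ℝ (Fin n)))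
    {a : Fin n → ℝ} (ha : ∀ k, 0 ≤ a k) (hsum : 0 < ∑ k, a k) {ε δ : ℝ}
    (hε : ε ∈ Set.Ioo (0 : ℝ) (1 / 3)) (hδ : 0 < δ)
    (hs : 8 * Real.log (2 / δ) / ε ^ 2 ≤ s) :
    1 - ENNReal.ofReal δ ≤ gaussianVecs s n
      {g | s * (1 - ε) * ∑ k, a k < ∑ i, ∑ k, a k * b.repr (WithLp.toLp 2 (g i)) k ^ 2 ∧
        ∑ i, ∑ k, a k * b.repr (WithLp.toLp 2 (g i)) k ^ 2 < s * (1 + ε) * ∑ k, a k} := by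
  set T := ∑ k, a k with hT
  convert gaussianVecs_concentration_of_sum_eq_one b (a := fun k ↦ a k / T)
    (fun k ↦ div_nonneg (ha k) hsum.le) (by rw [← Finset.sum_div, div_self hsum.ne']) hε hδ hs
    using 4 with g
  simp only [div_mul_eq_mul_div, ← Finset.sum_div]
  rw [lt_div_iff₀ hsum, div_lt_iff₀ hsum]

lemma abs_logb_sub_logb_le {x y r : ℝ} (hx : 0 < x) (hy : 0 < y) (hr : 0 < r) (hr1 : r ≤ 1)
    (h1 : r * x ≤ y) (h2 : r * y ≤ x) :
    |Real.logb 2 x - Real.logb 2 y| ≤ |Real.logb 2 r| := by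
  have hl : Real.logb 2 r ≤ 0 := Real.logb_nonpos one_lt_two hr.le hr1
  have e1 := Real.logb_le_logb_of_le one_lt_two (by positivity) h1
  have e2 := Real.logb_le_logb_of_le one_lt_two (by positivity) h2
  rw [Real.logb_mul hr.ne' hx.ne'] at e1
  rw [Real.logb_mul hr.ne' hy.ne'] at e2
  rw [abs_of_nonpos hl, abs_le]
  constructor <;> linarith

/-- Taylor-series estimator for fractional-order matrix-based Rényi entropy,
full-rank case. `S_α(G) = (1/(1−α))·log₂(Σᵢ λᵢ(G)^α)` and the estimator is
`S̃_α(G) = (1/(1−α))·log₂((λ_max^α/s)·Σᵢ Σ_{j=0}^m binom(α,j)·gᵢᵀ(G/λ_max − I)ʲ gᵢ)`. -/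
theorem stmt3 {n : ℕ} (G : Matrix (Fin n) (Fin n) ℝ) (hG : G.PosDef)
    (lmin lmax κ : ℝ)
    (hlmin : lmin = ⨅ i, hG.isHermitian.eigenvalues i) (hlminpos : 0 < lmin)
    (hlmax : lmax = ⨆ i, hG.isHermitian.eigenvalues i)
    (hκ : κ = lmax / lmin)
    (α : ℝ) (hα : 0 < α) (hαni : ∀ k : ℕ, α ≠ k) (hα1 : α ≠ 1)
    (ε δ : ℝ) (hε : ε ∈ Set.Ioo (0 : ℝ) (1 / 3)) (hδ : δ ∈ Set.Ioo (0 : ℝ) 1)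
    (s : ℕ) (hs : s = ⌈8 * Real.log (2 / δ) / ε ^ 2⌉₊)
    (m : ℕ) (hm : α < m)
    (hmcond : κ ^ (α + 1) * Real.Gamma (α + 1) * (1 - 1 / κ) ^ (m + 1)
        ≤ ε * Real.pi * ((m : ℝ) - α + 1) ^ (α + 1)) :
    1 - ENNReal.ofReal δ ≤
      gaussianVecs s n
        {g | |(1 / (1 - α)) * Real.logb 2 (∑ i, hG.isHermitian.eigenvalues i ^ α)
              - (1 / (1 - α)) * Real.logb 2
                  ((lmax ^ α / (s : ℝ)) * ∑ i, ∑ j ∈ Finset.range (m + 1),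
                    rchoose α j * (g i ⬝ᵥ (((1 / lmax) • G - 1) ^ j).mulVec (g i)))|
            ≤ |(1 / (1 - α)) * Real.logb 2 (1 - 3 * ε)|} := by
  obtain ⟨hε0, hε1⟩ := hε
  obtain ⟨hδ0, hδ1⟩ := hδ
  set l := hG.isHermitian.eigenvalues with hl
  have hne : Nonempty (Fin n) := by
    by_contra h
    rw [not_nonempty_iff] at h
    rw [hlmin, Real.iInf_of_isEmpty] at hlminpos
    exact lt_irrefl _ hlminpos
  have hle : ∀ k, l k ≤ lmax := fun k ↦ hlmax ▸ le_ciSup (Set.finite_range l).bddAbove k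
  have hge : ∀ k, lmin ≤ l k := fun k ↦ hlmin ▸ ciInf_le (Set.finite_range l).bddBelow k
  have hmax : 0 < lmax := by
    obtain ⟨k⟩ := hne
    linarith [hle k, hge k]
  have hκ0 : 0 < κ := hκ ▸ div_pos hmax hlminpos
  have hs8 : 8 * Real.log (2 / δ) / ε ^ 2 ≤ s := hs ▸ Nat.le_ceil _
  have hs0 : 0 < (s : ℝ) := by
    have : 0 < Real.log (2 / δ) := Real.log_pos (by rw [lt_div_iff₀ hδ0]; linarith)
    exact lt_of_lt_of_le (by positivity) hs8
  set x : Fin n → ℝ := fun k ↦ 1 / lmax * l k with hx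
  have hx0 : ∀ k, 1 / κ ≤ x k := fun k ↦ by
    simp only [hκ, hx, one_div_div, div_mul_eq_mul_div, one_mul]
    exact div_le_div_of_nonneg_right (hge k) hmax.le
  have hx1 : ∀ k, x k ≤ 1 := fun k ↦ by
    simp only [hx, div_mul_eq_mul_div, one_mul]
    exact (div_le_one hmax).mpr (hle k)
  have hxp : ∀ k, 0 < x k := fun k ↦ lt_of_lt_of_le (by positivity) (hx0 k)
  set a : Fin n → ℝ := fun k ↦ ∑ j ∈ Finset.range (m + 1), rchoose α j * (x k - 1) ^ j with ha
  have hax : ∀ k, |a k - x k ^ α| ≤ ε * x k ^ α := fun k ↦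
    abs_taylor_sub_rpow_le hα hαni hm hκ0 (hx0 k) (hx1 k) hmcond
  set X := ∑ k, x k ^ α with hX
  have hXp : 0 < X := Finset.sum_pos (fun k _ ↦ Real.rpow_pos_of_pos (hxp k) _)
    Finset.univ_nonempty
  have hTl : (1 - ε) * X ≤ ∑ k, a k := by
    rw [hX, Finset.mul_sum]
    exact Finset.sum_le_sum fun k _ ↦ by linarith [(abs_le.mp (hax k)).1]
  have hTu : ∑ k, a k ≤ (1 + ε) * X := by
    rw [hX, Finset.mul_sum]
    exact Finset.sum_le_sum fun k _ ↦ by linarith [(abs_le.mp (hax k)).2]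
  have ha0 : ∀ k, 0 ≤ a k := fun k ↦ by
    have := Real.rpow_pos_of_pos (hxp k) α
    nlinarith [(abs_le.mp (hax k)).1]
  have hT0 : 0 < ∑ k, a k := lt_of_lt_of_le (mul_pos (by linarith) hXp) hTl
  have hS : ∑ k, l k ^ α = lmax ^ α * X := by
    rw [hX, Finset.mul_sum]
    refine Finset.sum_congr rfl fun k _ ↦ ?_
    rw [← Real.mul_rpow hmax.le (hxp k).le]
    congr 1
    simp only [hx]
    field_simp
  have hlα : 0 < lmax ^ α := Real.rpow_pos_of_pos hmax _
  refine (gaussianVecs_concentration hG.isHermitian.eigenvectorBasis ha0 hT0 ⟨hε0, hε1⟩ hδ0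
    hs8).trans (measure_mono ?_)
  rintro g ⟨hg1, hg2⟩
  have hQ : ∑ i, ∑ j ∈ Finset.range (m + 1),
        rchoose α j * (g i ⬝ᵥ (((1 / lmax) • G - 1) ^ j).mulVec (g i))
      = ∑ i, ∑ k, a k * hG.isHermitian.eigenvectorBasis.repr (WithLp.toLp 2 (g i)) k ^ 2 := by
    refine Finset.sum_congr rfl fun i _ ↦ ?_
    simp only [dotProduct_pow_mulVec_eq_sum hG.isHermitian, ha, Finset.mul_sum, Finset.sum_mul]
    rw [Finset.sum_comm]
    simp only [hx, mul_assoc, ← hl]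
  simp only [Set.mem_ofPred_eq]
  rw [hQ, hS, ← mul_sub, abs_mul, abs_mul]
  set Q := ∑ i, ∑ k, a k * hG.isHermitian.eigenvectorBasis.repr (WithLp.toLp 2 (g i)) k ^ 2
  refine mul_le_mul_of_nonneg_left ?_ (abs_nonneg _)
  have hQl : (1 - 3 * ε) * X ≤ Q / s := by
    rw [le_div_iff₀ hs0]
    refine le_trans ?_ hg1.le
    have h := mul_le_mul_of_nonneg_left hTl (show 0 ≤ s * (1 - ε) by
      exact mul_nonneg hs0.le (by linarith))
    refine le_trans ?_ h
    have : 0 ≤ s * X * (ε + ε ^ 2) := by positivity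
    linarith
  have hQu : (1 - 3 * ε) * (Q / s) ≤ X := by
    have h : Q / s ≤ (1 + ε) * ((1 + ε) * X) := by
      rw [div_le_iff₀ hs0]
      refine hg2.le.trans ?_
      have h := mul_le_mul_of_nonneg_left hTu (show 0 ≤ s * (1 + ε) by positivity)
      linarith
    refine (mul_le_mul_of_nonneg_left h (by linarith)).trans ?_
    have : 0 ≤ X * (ε + 5 * ε ^ 2 + 3 * ε ^ 3) := by positivity
    linarith
  have hQp : 0 < Q / s := lt_of_lt_of_le (mul_pos (by linarith) hXp) hQl
  rw [show lmax ^ α / s * Q = lmax ^ α * (Q / s) by ring]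
  refine abs_logb_sub_logb_le (by positivity) (mul_pos hlα hQp) (by linarith) (by linarith) ?_ ?_
  · have := mul_le_mul_of_nonneg_left hQl hlα.le
    linarith
  · have := mul_le_mul_of_nonneg_left hQu hlα.le
    linarith
end
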